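/- arXiv:1507.08706 — 5 statements merged into one kernel-verified Lean document; each statement's English description precedes it below -/
import Mathlib

section
/- Let A > 0. Then the equation A·(1 + 1/x²)·exp(−x²) = x² has exactly one solution x = η in (0,∞). -/
open Real

lemma one_add_inv_sq_mul_exp_neg_sq_strictAntiOn :
    StrictAntiOn (fun x : ℝ => (1 + 1 / x ^ 2) * Real.exp (-x ^ 2)) (Set.Ioi 0) := by
  intro x (hx : 0 < x) z _ hxz
  dsimp only
  gcongr

lemma exists_pos_sq_sq_mul_exp_sq_div_eq {A : ℝ} (hA : 0 < A) :
    ∃ x : ℝ, 0 < x ∧ (x ^ 2) ^ 2 * Real.exp (x ^ 2) / (x ^ 2 + 1) = A := by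
  have hcont : ContinuousOn (fun x : ℝ => (x ^ 2) ^ 2 * Real.exp (x ^ 2) / (x ^ 2 + 1))
      (Set.Icc 0 (A + 1)) :=
    ContinuousOn.div (by fun_prop) (by fun_prop) fun x _ => by positivity
  have hA1 : A ≤ ((A + 1) ^ 2) ^ 2 * Real.exp ((A + 1) ^ 2) / ((A + 1) ^ 2 + 1) := by
    rw [le_div_iff₀ (by positivity)]
    have hpow : A ≤ ((A + 1) ^ 2) ^ 2 := by nlinarith [sq_nonneg (A ^ 2 + 2 * A)]
    exact mul_le_mul hpow (Real.add_one_le_exp _) (by positivity) (by positivity)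
  obtain ⟨x, hx, hxA⟩ := intermediate_value_Icc (by linarith) hcont ⟨by simpa using hA.le, hA1⟩
  refine ⟨x, hx.1.lt_of_ne ?_, hxA⟩
  rintro rfl
  simp [hA.ne] at hxA

/-- For `A > 0`, the equation `A·(1 + 1/x²)·exp(−x²) = x²` has exactly one solution in `(0,∞)`. -/
theorem eta5_equation_unique_positive_solution (A : ℝ) (hA : 0 < A) :
    ∃! x : ℝ, 0 < x ∧ A * (1 + 1 / x ^ 2) * Real.exp (-x ^ 2) = x ^ 2 := by
  obtain ⟨x, hx, hxA⟩ := exists_pos_sq_sq_mul_exp_sq_div_eq hA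
  have hne : ∀ u v : ℝ, 0 < u → u < v → A * (1 + 1 / u ^ 2) * Real.exp (-u ^ 2) = u ^ 2 →
      A * (1 + 1 / v ^ 2) * Real.exp (-v ^ 2) ≠ v ^ 2 := by
    intro u v hu huv hEu hEv
    have hlt := mul_lt_mul_of_pos_left
      (one_add_inv_sq_mul_exp_neg_sq_strictAntiOn hu (hu.trans huv) huv) hA
    have hsq : u ^ 2 < v ^ 2 := by gcongr
    simp only [← mul_assoc] at hlt
    linarith
  have hEx : A * (1 + 1 / x ^ 2) * Real.exp (-x ^ 2) = x ^ 2 := by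
    rw [← hxA, Real.exp_neg]
    field_simp
  refine ⟨x, ⟨hx, hEx⟩, ?_⟩
  rintro z ⟨hz, hEz⟩
  rcases lt_trichotomy z x with h | h | h
  · exact absurd hEx (hne z x hz h hEz)
  · exact h
  · exact absurd hEz (hne x z hx h hEx)
end

section
/- Let b > 0 and C > 0. Define g₁₃(x) = exp(−x²)/erf(x) and h₁₃(x) = x + b·exp(x²)·erf(x) for x > 0. Then g₁₃ is strictly decreasing on (0,∞) with g₁₃(x) → +∞ as x → 0⁺ and g₁₃(x) → 0 as x → +∞, h₁₃ is strictly increasing on (0,∞) with h₁₃(x) → 0 as x → 0⁺ and h₁₃(x) → +∞ as x → +∞, and consequently the equation g₁₃(x) = C·h₁₃(x) has exactly one solution in (0,∞). -/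
open Real Filter Set

/-- The Gauss error function `erf z = (2/√π) ∫₀ᶻ exp(−s²) ds`. -/
noncomputable def erf (z : ℝ) : ℝ := 2 / Real.sqrt π * ∫ s in (0:ℝ)..z, Real.exp (-s ^ 2)

theorem erf_zero : erf 0 = 0 := by simp [erf]

theorem continuous_erf : Continuous erf := by
  unfold erf
  refine continuous_const.mul (intervalIntegral.continuous_primitive (fun a b => ?_) 0)
  exact Continuous.intervalIntegrable (by fun_prop) a b

theorem erf_strictMono : StrictMono erf := by
  intro x y hxy
  have hint : ∀ a b : ℝ,
      IntervalIntegrable (fun s : ℝ => Real.exp (-s ^ 2)) MeasureTheory.volume a b :=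
    fun a b => Continuous.intervalIntegrable (by fun_prop) a b
  have hpos : 0 < ∫ s in x..y, Real.exp (-s ^ 2) :=
    intervalIntegral.intervalIntegral_pos_of_pos (hint x y) (fun s => Real.exp_pos _) hxy
  have hadd := intervalIntegral.integral_add_adjacent_intervals (hint 0 x) (hint x y)
  exact mul_lt_mul_of_pos_left (by linarith) (by positivity)

theorem erf_pos {x : ℝ} (hx : 0 < x) : 0 < erf x := erf_zero ▸ erf_strictMono hx

theorem tendsto_erf_nhdsGT_zero : Tendsto erf (nhdsWithin 0 (Ioi 0)) (nhdsWithin 0 (Ioi 0)) := by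
  refine tendsto_nhdsWithin_iff.2 ⟨?_, eventually_mem_nhdsWithin.mono fun x hx => erf_pos hx⟩
  exact (continuous_erf.tendsto' 0 0 erf_zero).mono_left nhdsWithin_le_nhds

theorem strictAntiOn_exp_neg_sq_div_erf :
    StrictAntiOn (fun x => Real.exp (-x ^ 2) / erf x) (Ioi 0) := by
  intro x hx y hy hxy
  have hx' : 0 < x := hx
  have hxe := erf_pos hx'
  have hsq : -y ^ 2 < -x ^ 2 := by nlinarith
  exact div_lt_div₀ (Real.exp_lt_exp.2 hsq) (erf_strictMono hxy).le (Real.exp_pos _).le hxe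

theorem tendsto_exp_neg_sq_div_erf_nhdsGT_zero :
    Tendsto (fun x => Real.exp (-x ^ 2) / erf x) (nhdsWithin 0 (Ioi 0)) atTop := by
  have hexp : Tendsto (fun x : ℝ => Real.exp (-x ^ 2)) (nhdsWithin 0 (Ioi 0)) (nhds 1) :=
    (Continuous.tendsto' (by fun_prop) 0 1 (by simp)).mono_left nhdsWithin_le_nhds
  simpa only [div_eq_mul_inv, Function.comp_def] using
    hexp.pos_mul_atTop one_pos (tendsto_inv_nhdsGT_zero.comp tendsto_erf_nhdsGT_zero)

theorem tendsto_exp_neg_sq_div_erf_atTop :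
    Tendsto (fun x => Real.exp (-x ^ 2) / erf x) atTop (nhds 0) := by
  have hexp : Tendsto (fun x : ℝ => Real.exp (-x ^ 2) / erf 1) atTop (nhds 0) := by
    simpa using (Real.tendsto_exp_atBot.comp
      (tendsto_neg_atTop_atBot.comp (tendsto_pow_atTop two_ne_zero))).div_const (erf 1)
  refine squeeze_zero' ?_ ?_ hexp
  · filter_upwards [eventually_gt_atTop 0] with x hx
    exact div_nonneg (Real.exp_pos _).le (erf_pos hx).le
  · filter_upwards [eventually_ge_atTop 1] with x hx
    exact div_le_div_of_nonneg_left (Real.exp_pos _).le (erf_pos one_pos)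
      (erf_strictMono.monotone hx)

theorem strictMonoOn_add_mul_exp_sq_mul_erf {b : ℝ} (hb : 0 < b) :
    StrictMonoOn (fun x => x + b * Real.exp (x ^ 2) * erf x) (Ioi 0) := by
  intro x hx y hy hxy
  have hx' : 0 < x := hx
  have hsq : x ^ 2 ≤ y ^ 2 := by nlinarith
  have hxe := (erf_pos hx').le
  have herf := erf_strictMono hxy
  dsimp only
  gcongr

theorem tendsto_add_mul_exp_sq_mul_erf_atTop {b : ℝ} (hb : 0 < b) :
    Tendsto (fun x => x + b * Real.exp (x ^ 2) * erf x) atTop atTop := by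
  refine tendsto_atTop_mono' _ ?_ tendsto_id
  filter_upwards [eventually_gt_atTop 0] with x hx
  have hxe := erf_pos hx
  have : 0 < b * Real.exp (x ^ 2) * erf x := by positivity
  simpa using this.le

/-- A continuous function on `(0, ∞)` that decreases strictly from `+∞` to a finite limit meets a
continuous function that increases strictly to `+∞` from a finite limit exactly once. -/
theorem existsUnique_pos_eq_of_strictAntiOn_of_strictMonoOn {u v : ℝ → ℝ} {l m : ℝ}
    (hu : ContinuousOn u (Ioi 0)) (hv : ContinuousOn v (Ioi 0))
    (hanti : StrictAntiOn u (Ioi 0)) (hmono : StrictMonoOn v (Ioi 0))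
    (hu₀ : Tendsto u (nhdsWithin 0 (Ioi 0)) atTop) (hu₁ : Tendsto u atTop (nhds l))
    (hv₀ : Tendsto v (nhdsWithin 0 (Ioi 0)) (nhds m)) (hv₁ : Tendsto v atTop atTop) :
    ∃! x : ℝ, 0 < x ∧ u x = v x := by
  have hle₀ : ∀ᶠ x in nhdsWithin 0 (Ioi 0), v x ≤ u x := by
    filter_upwards [hu₀.eventually_ge_atTop (m + 1),
      hv₀.eventually (eventually_le_nhds (lt_add_one m))] with x h₁ h₂ using h₂.trans h₁
  have hle₁ : ∀ᶠ x in atTop, u x ≤ v x := by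
    filter_upwards [hv₁.eventually_ge_atTop (l + 1),
      hu₁.eventually (eventually_le_nhds (lt_add_one l))] with x h₁ h₂ using h₂.trans h₁
  obtain ⟨p, hp, hp₀⟩ := (hle₀.and eventually_mem_nhdsWithin).exists
  obtain ⟨q, hq, hq₀⟩ := (hle₁.and (eventually_gt_atTop 0)).exists
  obtain ⟨x, hx, hxeq⟩ := isPreconnected_Ioi.intermediate_value₂ hq₀ hp₀ hu hv hq hp
  refine ⟨x, ⟨hx, hxeq⟩, fun y ⟨hy, hyeq⟩ => ?_⟩
  rcases lt_trichotomy y x with hlt | heq | hlt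
  · have h₁ := hanti hy hx hlt
    have h₂ := hmono hy hx hlt
    linarith
  · exact heq
  · have h₁ := hanti hx hy hlt
    have h₂ := hmono hx hy hlt
    linarith

/-- For `b > 0` and `C > 0`: `g₁₃(x) = exp(−x²)/erf(x)` is strictly decreasing on `(0,∞)` with
`g₁₃ → +∞` at `0⁺` and `g₁₃ → 0` at `+∞`; `h₁₃(x) = x + b·exp(x²)·erf(x)` is strictly
increasing on `(0,∞)` with `h₁₃ → 0` at `0⁺` and `h₁₃ → +∞` at `+∞`; consequently the
equation `g₁₃(x) = C·h₁₃(x)` has exactly one solution in `(0,∞)`. -/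
theorem g13_h13_shape_and_equation_E13 (b C : ℝ) (hb : 0 < b) (hC : 0 < C)
    (g h : ℝ → ℝ)
    (hg : ∀ x : ℝ, g x = Real.exp (-x ^ 2) / erf x)
    (hh : ∀ x : ℝ, h x = x + b * Real.exp (x ^ 2) * erf x) :
    StrictAntiOn g (Set.Ioi 0) ∧
    Tendsto g (nhdsWithin 0 (Set.Ioi 0)) atTop ∧
    Tendsto g atTop (nhds 0) ∧
    StrictMonoOn h (Set.Ioi 0) ∧
    Tendsto h (nhdsWithin 0 (Set.Ioi 0)) (nhds 0) ∧
    Tendsto h atTop atTop ∧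
    (∃! x : ℝ, 0 < x ∧ g x = C * h x) := by
  obtain rfl : g = fun x => Real.exp (-x ^ 2) / erf x := funext hg
  obtain rfl : h = fun x => x + b * Real.exp (x ^ 2) * erf x := funext hh
  have herf := continuous_erf
  have hcont : Continuous fun x => x + b * Real.exp (x ^ 2) * erf x := by fun_prop
  have hmono := strictMonoOn_add_mul_exp_sq_mul_erf hb
  have hzero : Tendsto (fun x => x + b * Real.exp (x ^ 2) * erf x)
      (nhdsWithin 0 (Ioi 0)) (nhds 0) :=
    (hcont.tendsto' 0 0 (by simp [erf_zero])).mono_left nhdsWithin_le_nhds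
  have htop := tendsto_add_mul_exp_sq_mul_erf_atTop hb
  refine ⟨strictAntiOn_exp_neg_sq_div_erf, tendsto_exp_neg_sq_div_erf_nhdsGT_zero,
    tendsto_exp_neg_sq_div_erf_atTop, hmono, hzero, htop, ?_⟩
  refine existsUnique_pos_eq_of_strictAntiOn_of_strictMonoOn ?_ (hcont.const_mul C).continuousOn
    strictAntiOn_exp_neg_sq_div_erf
    (fun x hx y hy hxy => mul_lt_mul_of_pos_left (hmono hx hy hxy) hC)
    tendsto_exp_neg_sq_div_erf_nhdsGT_zero tendsto_exp_neg_sq_div_erf_atTop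
    (hzero.const_mul C) (htop.const_mul_atTop hC)
  exact ContinuousOn.div (by fun_prop) herf.continuousOn fun x hx => (erf_pos hx).ne'
end

section
/- Let a > 1. Then the equation a(1 − 2x²) = exp(x²) has exactly one solution x = η in (0,∞). -/
open Real

/-- For `a > 1`, the equation `a(1 − 2x²) = exp(x²)` has exactly one solution in `(0,∞)`. -/
theorem eta14_equation_unique_positive_solution (a : ℝ) (ha : 1 < a) :
    ∃! x : ℝ, 0 < x ∧ a * (1 - 2 * x ^ 2) = Real.exp (x ^ 2) := by
  have hcont : ContinuousOn (fun x : ℝ => a * (1 - 2 * x ^ 2) - Real.exp (x ^ 2))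
      (Set.Icc 0 1) := by fun_prop
  have hzero : (0 : ℝ) ∈ Set.Ioo (a * (1 - 2 * (1 : ℝ) ^ 2) - Real.exp ((1 : ℝ) ^ 2))
      (a * (1 - 2 * (0 : ℝ) ^ 2) - Real.exp ((0 : ℝ) ^ 2)) := by
    constructor
    · linarith [Real.exp_pos ((1 : ℝ) ^ 2)]
    · norm_num
      exact ha
  obtain ⟨η, hη, heq⟩ := intermediate_value_Ioo' zero_le_one hcont hzero
  have hanti : StrictAntiOn (fun x : ℝ => a * (1 - 2 * x ^ 2) - Real.exp (x ^ 2))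
      (Set.Ioi 0) := by
    intro x hx y _ hxy
    have hsq : x ^ 2 < y ^ 2 := pow_lt_pow_left₀ hxy (le_of_lt hx) two_ne_zero
    have hexp := Real.exp_lt_exp.mpr hsq
    dsimp only
    nlinarith
  refine ⟨η, ⟨hη.1, sub_eq_zero.mp heq⟩, fun y hy => ?_⟩
  exact hanti.injOn hy.1 hη.1 ((sub_eq_zero.mpr hy.2).trans heq.symm)
end

section
/- Let q₀, h₀, D∞, σ, l, k, ρ, c be positive constants, set α = k/(ρc), and suppose equation (E2) holds: erf(σ/√α) = (k D∞/(q₀√(απ)))(1 − q₀/(h₀ D∞)). Then the following are equivalent: (i) there exist ε ∈ (0,1) and γ > 0 such that (E1) holds: q₀/(ρ l) = [σ + (γ k (1−ε)/(2q₀))·exp(σ²/α)]·exp(σ²/α); (ii) (q₀/(ρ l σ))·exp(−σ²/α) − 1 > 0. Moreover, when (ii) holds, for every ε ∈ (0,1) the unique γ > 0 making (E1) hold is γ = (2q₀σ/(k(1−ε)))·((q₀/(ρ l σ))·exp(−σ²/α) − 1)·exp(−σ²/α); in particular the system (E1)–(E2) has infinitely many solutions (ε, γ). -/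
open Real Set

/-- The balance equation at the interface, solved for the mushy-zone coefficient `γ`. -/
theorem interface_balance_iff_gamma_eq {q σ l k ρ ε γ E : ℝ} (hq : q ≠ 0) (hσ : σ ≠ 0) (hl : l ≠ 0)
    (hk : k ≠ 0) (hρ : ρ ≠ 0) (hε : 1 - ε ≠ 0) (hE : E ≠ 0) :
    q / (ρ * l) = (σ + γ * k * (1 - ε) / (2 * q) * E) * E ↔
      γ = 2 * q * σ / (k * (1 - ε)) * (q / (ρ * l * σ) * E⁻¹ - 1) * E⁻¹ := by
  have key : (σ + γ * k * (1 - ε) / (2 * q) * E) * E - q / (ρ * l) =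
      k * (1 - ε) / (2 * q) * E ^ 2 *
        (γ - 2 * q * σ / (k * (1 - ε)) * (q / (ρ * l * σ) * E⁻¹ - 1) * E⁻¹) := by
    field_simp
    ring
  have hne : k * (1 - ε) / (2 * q) * E ^ 2 ≠ 0 := by positivity
  rw [eq_comm, ← sub_eq_zero, key, mul_eq_zero_iff_left hne, sub_eq_zero]

/-- Case 1 (determination of `ε` and `γ`): with `α = k/(ρc)` and assuming (E2),
there exist `ε ∈ (0,1)` and `γ > 0` satisfying (E1) iff
`(q₀/(ρlσ))·exp(−σ²/α) − 1 > 0` (restriction (R1)); moreover, when (R1) holds, for every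
`ε ∈ (0,1)` the unique `γ > 0` satisfying (E1) is
`γ = (2q₀σ/(k(1−ε)))·((q₀/(ρlσ))·exp(−σ²/α) − 1)·exp(−σ²/α)`, so the system (E1)–(E2)
has infinitely many solutions `(ε, γ)`. -/
theorem case1_epsilon_gamma (q₀ h₀ D σ l k ρ c α : ℝ)
    (hq : 0 < q₀) (hh : 0 < h₀) (hD : 0 < D) (hσ : 0 < σ) (hl : 0 < l)
    (hk : 0 < k) (hρ : 0 < ρ) (hc : 0 < c)
    (hα : α = k / (ρ * c))
    (hE2 : erf (σ / Real.sqrt α) =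
      k * D / (q₀ * Real.sqrt (α * π)) * (1 - q₀ / (h₀ * D))) :
    ((∃ ε γ : ℝ, ε ∈ Set.Ioo (0:ℝ) 1 ∧ 0 < γ ∧
        q₀ / (ρ * l) =
          (σ + γ * k * (1 - ε) / (2 * q₀) * Real.exp (σ ^ 2 / α)) * Real.exp (σ ^ 2 / α))
      ↔ 0 < q₀ / (ρ * l * σ) * Real.exp (-σ ^ 2 / α) - 1) ∧
    (0 < q₀ / (ρ * l * σ) * Real.exp (-σ ^ 2 / α) - 1 →
      (∀ ε ∈ Set.Ioo (0:ℝ) 1, ∀ γ : ℝ,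
        γ = 2 * q₀ * σ / (k * (1 - ε)) *
              (q₀ / (ρ * l * σ) * Real.exp (-σ ^ 2 / α) - 1) * Real.exp (-σ ^ 2 / α) →
        (0 < γ ∧
         q₀ / (ρ * l) =
           (σ + γ * k * (1 - ε) / (2 * q₀) * Real.exp (σ ^ 2 / α)) * Real.exp (σ ^ 2 / α) ∧
         ∀ γ' : ℝ, 0 < γ' →
           q₀ / (ρ * l) =
             (σ + γ' * k * (1 - ε) / (2 * q₀) * Real.exp (σ ^ 2 / α)) * Real.exp (σ ^ 2 / α) →
           γ' = γ)) ∧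
      {p : ℝ × ℝ | p.1 ∈ Set.Ioo (0:ℝ) 1 ∧ 0 < p.2 ∧
        q₀ / (ρ * l) =
          (σ + p.2 * k * (1 - p.1) / (2 * q₀) * Real.exp (σ ^ 2 / α)) *
            Real.exp (σ ^ 2 / α)}.Infinite) := by
  have hexp : Real.exp (-σ ^ 2 / α) = (Real.exp (σ ^ 2 / α))⁻¹ := by
    rw [neg_div, Real.exp_neg]
  rw [hexp]
  have hE := Real.exp_pos (σ ^ 2 / α)
  generalize Real.exp (σ ^ 2 / α) = E at hE ⊢
  have solve : ∀ ε ∈ Set.Ioo (0 : ℝ) 1, ∀ γ : ℝ,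
      q₀ / (ρ * l) = (σ + γ * k * (1 - ε) / (2 * q₀) * E) * E ↔
        γ = 2 * q₀ * σ / (k * (1 - ε)) * (q₀ / (ρ * l * σ) * E⁻¹ - 1) * E⁻¹ := fun ε hε γ =>
    interface_balance_iff_gamma_eq hq.ne' hσ.ne' hl.ne' hk.ne' hρ.ne' (sub_pos.2 hε.2).ne' hE.ne'
  have pos_iff : ∀ ε ∈ Set.Ioo (0 : ℝ) 1,
      0 < 2 * q₀ * σ / (k * (1 - ε)) * (q₀ / (ρ * l * σ) * E⁻¹ - 1) * E⁻¹ ↔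
        0 < q₀ / (ρ * l * σ) * E⁻¹ - 1 := by
    intro ε hε
    have hε' : 0 < 1 - ε := sub_pos.2 hε.2
    rw [mul_pos_iff_of_pos_right (inv_pos.2 hE), mul_pos_iff_of_pos_left (by positivity)]
  refine ⟨⟨?_, fun h => ?_⟩, fun h => ⟨?_, ?_⟩⟩
  · rintro ⟨ε, γ, hε, hγ, h⟩
    rw [solve ε hε] at h
    exact (pos_iff ε hε).1 (h ▸ hγ)
  · have hε : (1 / 2 : ℝ) ∈ Set.Ioo (0 : ℝ) 1 := by norm_num
    exact ⟨1 / 2, _, hε, (pos_iff _ hε).2 h, (solve _ hε _).2 rfl⟩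
  · rintro ε hε γ rfl
    exact ⟨(pos_iff ε hε).2 h, (solve ε hε _).2 rfl, fun γ' _ h' => (solve ε hε γ').1 h'⟩
  · refine Set.Infinite.of_image Prod.fst ((Set.Ioo_infinite (zero_lt_one' ℝ)).mono ?_)
    intro ε hε
    exact ⟨(ε, _), ⟨hε, (pos_iff ε hε).2 h, (solve ε hε _).2 rfl⟩, rfl⟩
end

section
/- Let q₀, h₀, D∞, σ, k, ρ, γ be positive constants and ε ∈ (0,1). Then there exist l > 0 and c > 0 satisfying, with α = k/(ρc), the system (E1): q₀/(ρ l) = [σ + (γ k (1−ε)/(2q₀))·exp(σ²/α)]·exp(σ²/α) and (E2): erf(σ/√α) = (k D∞/(q₀√(απ)))(1 − q₀/(h₀ D∞)), if and only if 0 < 1 − q₀/(h₀D∞) < 2q₀σ/(k D∞) (conditions (R2) and (R17)). In that case the solution is unique and is given by c = (k/ρ)(ξ/σ)² and l = (q₀/(ρσ))·exp(−ξ²) / (1 + (γk(1−ε)/(2q₀σ))·exp(ξ²)), where ξ is the unique positive solution of erf(ξ)/ξ = (kD∞/(q₀σ√π))(1 − q₀/(h₀D∞)). -/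
open Real Set

/-- Equation (E1) of the paper, with `α = k/(ρc)`. -/
def eqE1 (q₀ σ l k ρ c γ ε : ℝ) : Prop :=
  q₀ / (ρ * l) =
    (σ + γ * k * (1 - ε) / (2 * q₀) * Real.exp (σ ^ 2 / (k / (ρ * c)))) *
      Real.exp (σ ^ 2 / (k / (ρ * c)))

/-- Equation (E2) of the paper, with `α = k/(ρc)`. -/
def eqE2 (q₀ h₀ D σ k ρ c : ℝ) : Prop :=
  erf (σ / Real.sqrt (k / (ρ * c))) =
    k * D / (q₀ * Real.sqrt (k / (ρ * c) * π)) * (1 - q₀ / (h₀ * D))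

/-- The mean of `s ↦ exp (-s ^ 2)` over the interval from `0` to `x`. -/
noncomputable def gaussianMean (x : ℝ) : ℝ := ∫ t in (0:ℝ)..1, Real.exp (-(x * t) ^ 2)

theorem mul_gaussianMean (x : ℝ) :
    x * gaussianMean x = ∫ s in (0:ℝ)..x, Real.exp (-s ^ 2) := by
  simpa [gaussianMean] using
    intervalIntegral.mul_integral_comp_mul_left (a := 0) (b := 1)
      (f := fun s : ℝ => Real.exp (-s ^ 2)) x

theorem erf_eq_mul_gaussianMean (x : ℝ) : erf x = 2 / Real.sqrt π * (x * gaussianMean x) := by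
  rw [mul_gaussianMean, erf]

theorem gaussianMean_zero : gaussianMean 0 = 1 := by
  simp [gaussianMean]

theorem continuous_gaussianMean : Continuous gaussianMean :=
  intervalIntegral.continuous_parametric_intervalIntegral_of_continuous'
    (f := fun x t : ℝ => Real.exp (-(x * t) ^ 2)) (by fun_prop) 0 1

theorem gaussianMean_strictAntiOn : StrictAntiOn gaussianMean (Ici 0) := by
  intro x hx y _ hxy
  have hx : 0 ≤ x := hx
  refine intervalIntegral.integral_lt_integral_of_continuousOn_of_le_of_exists_lt one_pos
    (by fun_prop) (by fun_prop) (fun t ht => ?_) ⟨1, by simp, ?_⟩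
  · have ht : 0 ≤ t := ht.1.le
    gcongr
  · gcongr

theorem gaussianMean_pos (x : ℝ) : 0 < gaussianMean x :=
  intervalIntegral.intervalIntegral_pos_of_pos
    (Continuous.intervalIntegrable (by fun_prop) _ _) (fun _ => Real.exp_pos _) one_pos

theorem gaussianMean_lt_one {x : ℝ} (hx : 0 < x) : gaussianMean x < 1 :=
  gaussianMean_zero ▸ gaussianMean_strictAntiOn self_mem_Ici hx.le hx

theorem mul_gaussianMean_le {x : ℝ} (hx : 0 ≤ x) : x * gaussianMean x ≤ Real.sqrt π := by
  have hint : MeasureTheory.Integrable (fun s : ℝ => Real.exp (-s ^ 2)) := by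
    simpa using integrable_exp_neg_mul_sq one_pos
  have htotal : ∫ s : ℝ, Real.exp (-s ^ 2) = Real.sqrt π := by
    simpa using integral_gaussian 1
  rw [mul_gaussianMean, intervalIntegral.integral_of_le hx, ← htotal]
  exact MeasureTheory.setIntegral_le_integral hint
    (Filter.Eventually.of_forall fun s => (Real.exp_pos _).le)

theorem exists_gaussianMean_eq {m : ℝ} (hm : 0 < m) (hm1 : m < 1) :
    ∃ x, 0 < x ∧ gaussianMean x = m := by
  have hb : 0 < Real.sqrt π / m := by positivity
  have hle : gaussianMean (Real.sqrt π / m) ≤ m := by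
    have h := mul_gaussianMean_le hb.le
    rw [div_mul_eq_mul_div, div_le_iff₀ hm] at h
    exact le_of_mul_le_mul_left h (by positivity)
  obtain ⟨x, hx, hxm⟩ := intermediate_value_Icc' hb.le continuous_gaussianMean.continuousOn
    ⟨hle, gaussianMean_zero.symm ▸ hm1.le⟩
  refine ⟨x, hx.1.lt_of_ne ?_, hxm⟩
  rintro rfl
  exact hm1.ne (hxm.symm.trans gaussianMean_zero)

/-- The similarity parameter `x = σ / √(k / (ρ c))` determines `c`. -/
theorem div_sqrt_eq_iff {σ k ρ c x : ℝ} (hσ : 0 < σ) (hk : 0 < k) (hρ : 0 < ρ) (hc : 0 < c)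
    (hx : 0 < x) : σ / Real.sqrt (k / (ρ * c)) = x ↔ c = k / ρ * (x / σ) ^ 2 := by
  rw [← sq_eq_sq₀ (by positivity) hx.le, div_pow, Real.sq_sqrt (by positivity)]
  field_simp

theorem eqE2_iff {q₀ h₀ D σ k ρ c : ℝ} (hq : 0 < q₀) (hσ : 0 < σ) (hk : 0 < k) (hρ : 0 < ρ)
    (hc : 0 < c) :
    eqE2 q₀ h₀ D σ k ρ c ↔
      gaussianMean (σ / Real.sqrt (k / (ρ * c))) =
        k * D / (2 * q₀ * σ) * (1 - q₀ / (h₀ * D)) := by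
  have hα : 0 < k / (ρ * c) := by positivity
  have hs : 0 < Real.sqrt (k / (ρ * c)) := Real.sqrt_pos.2 hα
  have hπ : 0 < Real.sqrt π := Real.sqrt_pos.2 Real.pi_pos
  rw [eqE2, erf_eq_mul_gaussianMean, Real.sqrt_mul hα.le]
  generalize gaussianMean _ = g
  generalize 1 - q₀ / (h₀ * D) = r
  generalize Real.sqrt (k / (ρ * c)) = s at *
  field_simp

theorem erf_div_eq_iff {q₀ h₀ D σ k ξ : ℝ} (hq : 0 < q₀) (hσ : 0 < σ) (hξ : 0 < ξ) :
    erf ξ / ξ = k * D / (q₀ * σ * Real.sqrt π) * (1 - q₀ / (h₀ * D)) ↔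
      gaussianMean ξ = k * D / (2 * q₀ * σ) * (1 - q₀ / (h₀ * D)) := by
  have hπ : 0 < Real.sqrt π := Real.sqrt_pos.2 Real.pi_pos
  rw [erf_eq_mul_gaussianMean]
  generalize gaussianMean _ = g
  generalize 1 - q₀ / (h₀ * D) = r
  field_simp

theorem eqE1_iff {q₀ σ l k ρ c γ ε : ℝ} (hq : 0 < q₀) (hσ : 0 < σ) (hl : 0 < l) (hk : 0 < k)
    (hρ : 0 < ρ) (hc : 0 < c) (hγ : 0 < γ) (hε : ε < 1) :
    eqE1 q₀ σ l k ρ c γ ε ↔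
      l = q₀ / (ρ * σ) * Real.exp (-(σ / Real.sqrt (k / (ρ * c))) ^ 2) /
        (1 + γ * k * (1 - ε) / (2 * q₀ * σ) *
          Real.exp ((σ / Real.sqrt (k / (ρ * c))) ^ 2)) := by
  have hα : 0 < k / (ρ * c) := by positivity
  have hε' : 0 < 1 - ε := sub_pos.2 hε
  rw [eqE1, div_pow, Real.sq_sqrt hα.le, Real.exp_neg]
  have hE := Real.exp_pos (σ ^ 2 / (k / (ρ * c)))
  generalize Real.exp (σ ^ 2 / (k / (ρ * c))) = E at *
  generalize 1 - ε = δ at *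
  field_simp
  constructor <;> intro h <;> linarith


/-- Case 12 (determination of `l` and `c`): there exist `l > 0` and `c > 0` satisfying the
system (E1)–(E2) iff `0 < 1 − q₀/(h₀D∞) < 2q₀σ/(kD∞)` (restrictions (R2) and (R17)); in that
case the solution is unique and given by `c = (k/ρ)(ξ/σ)²` and
`l = (q₀/(ρσ))·exp(−ξ²)/(1 + (γk(1−ε)/(2q₀σ))·exp(ξ²))`, where `ξ` is the unique positive
solution of `erf(ξ)/ξ = (kD∞/(q₀σ√π))(1 − q₀/(h₀D∞))`. -/
theorem case12_l_c (q₀ h₀ D σ k ρ γ ε : ℝ)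
    (hq : 0 < q₀) (hh : 0 < h₀) (hD : 0 < D) (hσ : 0 < σ)
    (hk : 0 < k) (hρ : 0 < ρ) (hγ : 0 < γ) (hε : ε ∈ Set.Ioo (0:ℝ) 1) :
    ((∃ l c : ℝ, 0 < l ∧ 0 < c ∧ eqE1 q₀ σ l k ρ c γ ε ∧ eqE2 q₀ h₀ D σ k ρ c)
      ↔ (0 < 1 - q₀ / (h₀ * D) ∧ 1 - q₀ / (h₀ * D) < 2 * q₀ * σ / (k * D))) ∧
    ((0 < 1 - q₀ / (h₀ * D) ∧ 1 - q₀ / (h₀ * D) < 2 * q₀ * σ / (k * D)) →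
      ∀ ξ : ℝ, 0 < ξ →
        erf ξ / ξ = k * D / (q₀ * σ * Real.sqrt π) * (1 - q₀ / (h₀ * D)) →
        ∀ l c : ℝ, 0 < l → 0 < c →
          ((eqE1 q₀ σ l k ρ c γ ε ∧ eqE2 q₀ h₀ D σ k ρ c) ↔
            (c = k / ρ * (ξ / σ) ^ 2 ∧
             l = q₀ / (ρ * σ) * Real.exp (-ξ ^ 2) /
                   (1 + γ * k * (1 - ε) / (2 * q₀ * σ) * Real.exp (ξ ^ 2))))) := by
  have hε' : 0 < 1 - ε := sub_pos.2 hε.2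
  have hm1 : 1 - q₀ / (h₀ * D) < 2 * q₀ * σ / (k * D) ↔
      k * D / (2 * q₀ * σ) * (1 - q₀ / (h₀ * D)) < 1 := by
    rw [lt_div_iff₀ (by positivity), div_mul_eq_mul_div, div_lt_one (by positivity), mul_comm]
  have hm0 : 0 < 1 - q₀ / (h₀ * D) ↔ 0 < k * D / (2 * q₀ * σ) * (1 - q₀ / (h₀ * D)) :=
    (mul_pos_iff_of_pos_left (by positivity)).symm
  have key : ∀ ξ : ℝ, 0 < ξ →
      gaussianMean ξ = k * D / (2 * q₀ * σ) * (1 - q₀ / (h₀ * D)) →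
      ∀ l c : ℝ, 0 < l → 0 < c →
        ((eqE1 q₀ σ l k ρ c γ ε ∧ eqE2 q₀ h₀ D σ k ρ c) ↔
          (c = k / ρ * (ξ / σ) ^ 2 ∧
           l = q₀ / (ρ * σ) * Real.exp (-ξ ^ 2) /
                 (1 + γ * k * (1 - ε) / (2 * q₀ * σ) * Real.exp (ξ ^ 2)))) := by
    intro ξ hξ hg l c hl hc
    have hx : 0 < σ / Real.sqrt (k / (ρ * c)) := by positivity
    rw [eqE1_iff hq hσ hl hk hρ hc hγ hε.2, eqE2_iff hq hσ hk hρ hc, ← hg,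
      gaussianMean_strictAntiOn.injOn.eq_iff hx.le hξ.le, and_comm,
      ← div_sqrt_eq_iff hσ hk hρ hc hξ]
    exact and_congr_right fun h => by rw [h]
  refine ⟨⟨?_, ?_⟩, fun _ ξ hξ h => key ξ hξ ((erf_div_eq_iff hq hσ hξ).1 h)⟩
  · rintro ⟨l, c, -, hc, -, h2⟩
    rw [eqE2_iff hq hσ hk hρ hc] at h2
    rw [hm0, hm1, ← h2]
    exact ⟨gaussianMean_pos _, gaussianMean_lt_one (by positivity)⟩
  · rintro ⟨h0, h1⟩
    obtain ⟨ξ, hξ, hg⟩ := exists_gaussianMean_eq (hm0.1 h0) (hm1.1 h1)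
    have hl : 0 < q₀ / (ρ * σ) * Real.exp (-ξ ^ 2) /
        (1 + γ * k * (1 - ε) / (2 * q₀ * σ) * Real.exp (ξ ^ 2)) := by positivity
    have hc : 0 < k / ρ * (ξ / σ) ^ 2 := by positivity
    exact ⟨_, _, hl, hc, (key ξ hξ hg _ _ hl hc).2 ⟨rfl, rfl⟩⟩
end
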